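/- Suppose F_l(c) < ‖F_l − F_h‖ and ∫ v dμ_h(v) < ∞. Let κ be the unique solution of the κ-system at (c, α) with κ⁴ < v⋆ < κ⁵, and let ρ⋆ be the coupling of (F_l, F_h) defined by ρ⋆(A × B) = ∫_B γ⋆(v_h)(A) dμ_h(v_h). Then ρ⋆ maximizes the seller's matched-pair profit among all couplings: for every coupling ρ of (F_l, F_h), ∫ π dρ ≤ ∫ π dρ⋆. -/

import Mathlib

open MeasureTheory Set Filter

noncomputable section

/-- The cumulative distribution function of a Borel measure on `ℝ`. -/
def mCdf (μ : Measure ℝ) (v : ℝ) : ℝ := (μ (Iic v)).toReal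

/-- Total variation distance between two measures on `ℝ`:
the supremum over Borel sets `A` of `|μ A - ν A|`. -/
def tvDist (μ ν : Measure ℝ) : ℝ :=
  sSup {x : ℝ | ∃ A : Set ℝ, MeasurableSet A ∧ x = |(μ A).toReal - (ν A).toReal|}

/-- Generalized inverse of a CDF: `F⁻¹ q = inf {v | q ≤ F v}`. -/
def invCdf (F : ℝ → ℝ) (q : ℝ) : ℝ := sInf {v : ℝ | q ≤ F v}

/-- `ρ` is a coupling of `(μ, ν)` iff its marginals are `μ` and `ν`. -/
def IsCoupling (μ ν : Measure ℝ) (ρ : Measure (ℝ × ℝ)) : Prop :=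
  ρ.fst = μ ∧ ρ.snd = ν

/-- The market primitives: probability measures `μl, μh` on `ℝ` with densities
`fl, fh` positive exactly on a common interval `(vlo, vhi)` (with `vhi` possibly `∞`),
and a strictly increasing likelihood ratio `fh / fl` on that interval. -/
structure MarketData where
  μl : Measure ℝ
  μh : Measure ℝ
  fl : ℝ → ℝ
  fh : ℝ → ℝ
  vlo : ℝ
  vhi : EReal
  probl : IsProbabilityMeasure μl
  probh : IsProbabilityMeasure μh
  meas_fl : Measurable fl
  meas_fh : Measurable fh
  dens_l : μl = volume.withDensity (fun v => ENNReal.ofReal (fl v))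
  dens_h : μh = volume.withDensity (fun v => ENNReal.ofReal (fh v))
  vlo_nonneg : 0 ≤ vlo
  vlo_lt_vhi : (vlo : EReal) < vhi
  fl_nonneg : ∀ v, 0 ≤ fl v
  fh_nonneg : ∀ v, 0 ≤ fh v
  fl_pos_iff : ∀ v : ℝ, 0 < fl v ↔ (vlo < v ∧ (v : EReal) < vhi)
  fh_pos_iff : ∀ v : ℝ, 0 < fh v ↔ (vlo < v ∧ (v : EReal) < vhi)
  lr_strictMono : StrictMonoOn (fun v => fh v / fl v) {v : ℝ | vlo < v ∧ (v : EReal) < vhi}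

/-- CDF of the `l`-group. -/
def MarketData.Fl (D : MarketData) : ℝ → ℝ := mCdf D.μl

/-- CDF of the `h`-group. -/
def MarketData.Fh (D : MarketData) : ℝ → ℝ := mCdf D.μh

/-- `Δ v = F_l v − F_h v`. -/
def MarketData.Δ (D : MarketData) (v : ℝ) : ℝ := D.Fl v - D.Fh v

/-- `vstar` is the unique maximizer of `Δ`, characterized by `f_l vstar = f_h vstar`. -/
def IsVStar (D : MarketData) (vstar : ℝ) : Prop :=
  D.fl vstar = D.fh vstar ∧ (∀ v, D.Δ v ≤ D.Δ vstar) ∧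
  (∀ v, (∀ w, D.Δ w ≤ D.Δ v) → v = vstar)

/-- A vector `κ = (κ¹, κ², κ³, κ⁴, κ⁵) ∈ ℝ⁵`. -/
structure Kappa where
  k1 : ℝ
  k2 : ℝ
  k3 : ℝ
  k4 : ℝ
  k5 : ℝ

/-- The κ-system at `(c, α)` for the pair of CDFs `(Fl, Fh)`:
`κ¹ ≤ κ² ≤ κ³ ≤ κ⁴ ≤ κ⁵`,
`κ² = Fl⁻¹(Δ κ³ + Fh κ¹) = Fl⁻¹(Δ κ⁴) = Fl⁻¹(Δ κ⁵)` and
`κ¹ − c = (1 − α)(κ³ − c) = α (κ⁵ − κ⁴)`. -/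
def KappaSystem (Fl Fh : ℝ → ℝ) (c α : ℝ) (κ : Kappa) : Prop :=
  κ.k1 ≤ κ.k2 ∧ κ.k2 ≤ κ.k3 ∧ κ.k3 ≤ κ.k4 ∧ κ.k4 ≤ κ.k5 ∧
  κ.k2 = invCdf Fl ((Fl κ.k3 - Fh κ.k3) + Fh κ.k1) ∧
  κ.k2 = invCdf Fl (Fl κ.k4 - Fh κ.k4) ∧
  κ.k2 = invCdf Fl (Fl κ.k5 - Fh κ.k5) ∧
  κ.k1 - c = (1 - α) * (κ.k3 - c) ∧
  κ.k1 - c = α * (κ.k5 - κ.k4)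

/-- The pairwise profit from a matched pair `(v_l, v_h)`:
`max { min{v_l,v_h} − c, α(v_h − c)⁺, (1−α)(v_l − c)⁺ }`. -/
def pairProfit (c α vl vh : ℝ) : ℝ :=
  max (min vl vh - c) (max (α * max (vh - c) 0) ((1 - α) * max (vl - c) 0))

/-- The set of matched-pair profit values achievable by couplings of `(μl, μh)`. -/
def couplingValues (μl μh : Measure ℝ) (c α : ℝ) : Set ℝ :=
  {x : ℝ | ∃ ρ : Measure (ℝ × ℝ), IsCoupling μl μh ρ ∧
    x = ∫ p, pairProfit c α p.1 p.2 ∂ρ}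

/-- The smaller solution of `Δ v = q` (the generalized inverse of `Δ` on its
increasing part): `Δ̲⁻¹ q = inf {v | q ≤ Δ v}`. -/
def lowerDeltaInv (Δfn : ℝ → ℝ) (q : ℝ) : ℝ := sInf {v : ℝ | q ≤ Δfn v}

/-- The larger solution of `Δ v = q`: `Δ̄⁻¹ q = sup {v | q ≤ Δ v}`. -/
def upperDeltaInv (Δfn : ℝ → ℝ) (q : ℝ) : ℝ := sSup {v : ℝ | q ≤ Δfn v}

/-- The Markov kernel `γ⋆` describing the optimal matching of `l`-values to each
`h`-value `v_h`. -/
def gammaStar (D : MarketData) (κ : Kappa) (vh : ℝ) : Measure ℝ :=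
  if vh ≤ κ.k1 then
    Measure.dirac (lowerDeltaInv D.Δ (D.Fh vh + D.Δ κ.k3))
  else if vh ≤ κ.k3 then
    Measure.dirac (invCdf D.Fl (D.Fh vh + D.Δ κ.k3))
  else if vh ≤ κ.k4 then
    Measure.dirac vh
  else if vh ≤ κ.k5 then
    Measure.dirac (invCdf D.Fl (D.Fh vh + D.Δ κ.k4))
  else
    ENNReal.ofReal (D.fl vh / D.fh vh) • Measure.dirac vh +
      ENNReal.ofReal (1 - D.fl vh / D.fh vh) •
        Measure.dirac (invCdf D.Fl (D.Δ κ.k5 - D.Δ vh))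

section Potentials

variable {c α : ℝ} {κ : Kappa}

/-- The dual potential on the `l`-side. -/
def lPotential (α : ℝ) (κ : Kappa) (x : ℝ) : ℝ :=
  (1 - α) * (max x κ.k3 - κ.k3) + α * (min (max x κ.k4) κ.k5 - κ.k4)

/-- The dual potential on the `h`-side. -/
def hPotential (c α : ℝ) (κ : Kappa) (y : ℝ) : ℝ :=
  (κ.k1 - c) + (1 - α) * (min (max y κ.k1) κ.k3 - κ.k1)
    + α * (min (max y κ.k1) κ.k4 - κ.k1) + α * (max y κ.k5 - κ.k5)

lemma continuous_lPotential : Continuous (lPotential α κ) := by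
  unfold lPotential; fun_prop

lemma continuous_hPotential : Continuous (hPotential c α κ) := by
  unfold hPotential; fun_prop

lemma continuous_pairProfit : Continuous fun p : ℝ × ℝ => pairProfit c α p.1 p.2 := by
  unfold pairProfit; fun_prop

lemma pairProfit_nonneg (hα : α ∈ Ioo (0 : ℝ) 1) (x y : ℝ) : 0 ≤ pairProfit c α x y :=
  le_max_of_le_right <| le_max_of_le_left <| mul_nonneg hα.1.le (le_max_right _ _)

lemma integrable_lPotential {μ : Measure ℝ} [IsProbabilityMeasure μ]
    (h : Integrable (fun v : ℝ => v) μ) : Integrable (lPotential α κ) μ := by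
  have hc (a : ℝ) : Integrable (fun _ : ℝ => a) μ := integrable_const a
  exact (((h.sup (hc κ.k3)).sub (hc κ.k3)).const_mul (1 - α)).add
    ((((h.sup (hc κ.k4)).inf (hc κ.k5)).sub (hc κ.k4)).const_mul α)

lemma integrable_hPotential {μ : Measure ℝ} [IsProbabilityMeasure μ]
    (h : Integrable (fun v : ℝ => v) μ) : Integrable (hPotential c α κ) μ := by
  have hc (a : ℝ) : Integrable (fun _ : ℝ => a) μ := integrable_const a
  exact (((hc (κ.k1 - c)).add
    ((((h.sup (hc κ.k1)).inf (hc κ.k3)).sub (hc κ.k1)).const_mul (1 - α))).add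
    ((((h.sup (hc κ.k1)).inf (hc κ.k4)).sub (hc κ.k1)).const_mul α)).add
    (((h.sup (hc κ.k5)).sub (hc κ.k5)).const_mul α)

/-- The two potentials dominate the pairwise profit. -/
lemma pairProfit_le_potentials (hα : α ∈ Ioo (0 : ℝ) 1)
    (h13 : κ.k1 ≤ κ.k3) (h34 : κ.k3 ≤ κ.k4) (h45 : κ.k4 ≤ κ.k5)
    (e3 : κ.k1 - c = (1 - α) * (κ.k3 - c)) (e5 : κ.k1 - c = α * (κ.k5 - κ.k4)) (x y : ℝ) :
    pairProfit c α x y ≤ lPotential α κ x + hPotential c α κ y := by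
  obtain ⟨h0, h1⟩ := hα
  have h1' : 0 < 1 - α := sub_pos.2 h1
  have lmono {a b : ℝ} (h : a ≤ b) : lPotential α κ a ≤ lPotential α κ b := by
    unfold lPotential; gcongr
  have hmono {a b : ℝ} (h : a ≤ b) : hPotential c α κ a ≤ hPotential c α κ b := by
    unfold hPotential; gcongr
  have hk1 : 0 ≤ κ.k1 - c := e5 ▸ mul_nonneg h0.le (sub_nonneg.2 h45)
  have l0 : 0 ≤ lPotential α κ x := by
    unfold lPotential
    exact add_nonneg (mul_nonneg h1'.le (sub_nonneg.2 (le_max_right _ _)))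
      (mul_nonneg h0.le (sub_nonneg.2 (le_min (le_max_right _ _) h45)))
  have hge : κ.k1 - c ≤ hPotential c α κ y := by
    unfold hPotential
    have a1 := mul_nonneg h1'.le (sub_nonneg.2 (le_min (le_max_right y κ.k1) h13))
    have a2 := mul_nonneg h0.le (sub_nonneg.2 (le_min (le_max_right y κ.k1) (h13.trans h34)))
    have a3 := mul_nonneg h0.le (sub_nonneg.2 (le_max_right y κ.k5))
    linarith
  have hdiag (m : ℝ) : m - c ≤ lPotential α κ m + hPotential c α κ m := by
    unfold lPotential hPotential
    rcases le_total m κ.k1 with hm1 | hm1 <;> rcases le_total m κ.k3 with hm3 | hm3 <;>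
      rcases le_total m κ.k4 with hm4 | hm4 <;> rcases le_total m κ.k5 with hm5 | hm5 <;>
      simp only [max_eq_left, max_eq_right, min_eq_left, min_eq_right, *, h13.trans h34] <;>
      nlinarith
  refine max_le ?_ (max_le ?_ ?_)
  · exact (hdiag _).trans (add_le_add (lmono (min_le_left _ _)) (hmono (min_le_right _ _)))
  · rw [mul_max_of_nonneg _ _ h0.le, mul_zero]
    refine max_le ?_ (by linarith)
    suffices α * (y - c) ≤ hPotential c α κ y by linarith
    unfold hPotential
    rcases le_total y κ.k1 with hm1 | hm1 <;> rcases le_total y κ.k3 with hm3 | hm3 <;>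
      rcases le_total y κ.k4 with hm4 | hm4 <;> rcases le_total y κ.k5 with hm5 | hm5 <;>
      simp only [max_eq_left, max_eq_right, min_eq_left, min_eq_right, *, h13.trans h34] <;>
      nlinarith
  · rw [mul_max_of_nonneg _ _ h1'.le, mul_zero]
    refine max_le ?_ (by linarith)
    have a1 := mul_le_mul_of_nonneg_left (le_max_left x κ.k3) h1'.le
    have a2 := mul_nonneg h0.le (sub_nonneg.2 (le_min (le_max_right x κ.k4) h45))
    unfold lPotential
    linarith

end Potentials

lemma apply_invCdf_of_ne_zero {F : ℝ → ℝ} (hF : Continuous F) {q : ℝ} (h : invCdf F q ≠ 0) :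
    F (invCdf F q) = q := by
  have hne : {v : ℝ | q ≤ F v}.Nonempty := by
    by_contra hn
    exact h (by rw [invCdf, not_nonempty_iff_eq_empty.1 hn, Real.sInf_empty])
  have hbdd : BddBelow {v : ℝ | q ≤ F v} := by
    by_contra hn
    exact h (Real.sInf_of_not_bddBelow hn)
  refine le_antisymm ?_ ((isClosed_le continuous_const hF).csInf_mem hne hbdd)
  refine le_of_tendsto (hF.continuousWithinAt (s := Iio (invCdf F q))) ?_
  filter_upwards [self_mem_nhdsWithin] with v hv
  exact (not_le.1 fun hq => (notMem_of_lt_csInf hv hbdd) hq).le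

lemma continuous_mCdf (μ : Measure ℝ) [IsProbabilityMeasure μ] [NullSingletonClass μ] :
    Continuous (mCdf μ) := by
  have h : mCdf μ = ProbabilityTheory.cdf μ :=
    funext fun v => (ProbabilityTheory.cdf_eq_real μ v).symm
  rw [h, continuous_iff_continuousAt]
  intro x
  rw [(ProbabilityTheory.monotone_cdf μ).continuousAt_iff_leftLim_eq_rightLim,
    StieltjesFunction.rightLim_eq]
  have h0 := StieltjesFunction.measure_singleton (ProbabilityTheory.cdf μ) x
  rw [ProbabilityTheory.measure_cdf, measure_singleton] at h0
  exact le_antisymm ((ProbabilityTheory.monotone_cdf μ).leftLim_le le_rfl)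
    (sub_nonpos.1 (ENNReal.ofReal_eq_zero.1 h0.symm))

lemma mCdf_mono (μ : Measure ℝ) [IsFiniteMeasure μ] : Monotone (mCdf μ) := fun _ _ h =>
  ENNReal.toReal_mono (measure_ne_top _ _) (measure_mono (Iic_subset_Iic.2 h))

lemma mCdf_sub_mCdf (μ : Measure ℝ) [IsFiniteMeasure μ] {a b : ℝ} (h : a ≤ b) :
    mCdf μ b - mCdf μ a = μ.real (Ioc a b) := by
  rw [← Iic_sdiff_Iic, measureReal_sdiff (Iic_subset_Iic.2 h) measurableSet_Iic]; rfl

namespace MarketData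

variable (D : MarketData) {vstar : ℝ}

instance : IsProbabilityMeasure D.μl := D.probl
instance : IsProbabilityMeasure D.μh := D.probh
instance : NullSingletonClass D.μl := by rw [D.dens_l]; infer_instance
instance : NullSingletonClass D.μh := by rw [D.dens_h]; infer_instance

lemma continuous_Fl : Continuous D.Fl := continuous_mCdf _
lemma Fl_mono : Monotone D.Fl := mCdf_mono _
lemma Fh_mono : Monotone D.Fh := mCdf_mono _
lemma Fh_nonneg (v : ℝ) : 0 ≤ D.Fh v := ENNReal.toReal_nonneg

lemma ae_l_mem : ∀ᵐ v ∂D.μl, D.vlo < v ∧ (v : EReal) < D.vhi := by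
  rw [D.dens_l, ae_withDensity_iff D.meas_fl.ennreal_ofReal]
  exact .of_forall fun v hv => (D.fl_pos_iff v).1 (by simpa using hv)

lemma ae_h_mem : ∀ᵐ v ∂D.μh, D.vlo < v ∧ (v : EReal) < D.vhi := by
  rw [D.dens_h, ae_withDensity_iff D.meas_fh.ennreal_ofReal]
  exact .of_forall fun v hv => (D.fh_pos_iff v).1 (by simpa using hv)

lemma withDensity_Ioc_pos {f : ℝ → ℝ} (hm : Measurable f) {a b : ℝ}
    (hf : ∀ v, 0 < f v ↔ (D.vlo < v ∧ (v : EReal) < D.vhi)) (hab : a < b)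
    (hb : D.vlo < b ∧ (b : EReal) < D.vhi) :
    0 < (volume.withDensity fun v => ENNReal.ofReal (f v)) (Ioc a b) := by
  rw [pos_iff_ne_zero, Ne, withDensity_apply_eq_zero hm.ennreal_ofReal]
  have hsub : Ioc (max a D.vlo) b ⊆ {x | ENNReal.ofReal (f x) ≠ 0} ∩ Ioc a b := fun x hx =>
    ⟨by simpa using (hf x).2 ⟨(le_max_right _ _).trans_lt hx.1,
      (EReal.coe_le_coe_iff.2 hx.2).trans_lt hb.2⟩, (le_max_left _ _).trans_lt hx.1, hx.2⟩
  intro h0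
  have := measure_mono_null hsub h0
  rw [Real.volume_Ioc, ENNReal.ofReal_eq_zero, sub_nonpos] at this
  exact absurd this (not_le.2 (max_lt hab hb.1))

lemma Fl_lt {a b : ℝ} (hab : a < b) (hb : D.vlo < b ∧ (b : EReal) < D.vhi) :
    D.Fl a < D.Fl b := by
  rw [← sub_pos, Fl, mCdf_sub_mCdf _ hab.le]
  refine ENNReal.toReal_pos (ne_of_gt ?_) (measure_ne_top _ _)
  rw [D.dens_l]
  exact D.withDensity_Ioc_pos D.meas_fl D.fl_pos_iff hab hb

lemma Fh_lt {a b : ℝ} (hab : a < b) (hb : D.vlo < b ∧ (b : EReal) < D.vhi) :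
    D.Fh a < D.Fh b := by
  rw [← sub_pos, Fh, mCdf_sub_mCdf _ hab.le]
  refine ENNReal.toReal_pos (ne_of_gt ?_) (measure_ne_top _ _)
  rw [D.dens_h]
  exact D.withDensity_Ioc_pos D.meas_fh D.fh_pos_iff hab hb

lemma Fh_pos {b : ℝ} (hb : D.vlo < b ∧ (b : EReal) < D.vhi) : 0 < D.Fh b :=
  (D.Fh_nonneg _).trans_lt (D.Fh_lt (sub_one_lt b) hb)

lemma Δ_eq_zero_of_le {v : ℝ} (h : v ≤ D.vlo) : D.Δ v = 0 := by
  have hl : D.μl (Iic v) = 0 := by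
    rw [measure_eq_zero_iff_ae_notMem]
    filter_upwards [D.ae_l_mem] with x hx hxv using (hx.1.trans_le (hxv.trans h)).false
  have hh : D.μh (Iic v) = 0 := by
    rw [measure_eq_zero_iff_ae_notMem]
    filter_upwards [D.ae_h_mem] with x hx hxv using (hx.1.trans_le (hxv.trans h)).false
  simp [Δ, Fl, Fh, mCdf, hl, hh]

lemma Δ_eq_zero_of_ge {v : ℝ} (h : D.vhi ≤ v) : D.Δ v = 0 := by
  have hl : D.μl (Iic v) = 1 := by
    rw [← prob_compl_eq_zero_iff measurableSet_Iic, measure_eq_zero_iff_ae_notMem]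
    filter_upwards [D.ae_l_mem] with x hx hxv
    exact hxv (EReal.coe_le_coe_iff.1 (hx.2.le.trans h))
  have hh : D.μh (Iic v) = 1 := by
    rw [← prob_compl_eq_zero_iff measurableSet_Iic, measure_eq_zero_iff_ae_notMem]
    filter_upwards [D.ae_h_mem] with x hx hxv
    exact hxv (EReal.coe_le_coe_iff.1 (hx.2.le.trans h))
  simp [Δ, Fl, Fh, mCdf, hl, hh]

variable {D}

lemma vstar_mem (hv : IsVStar D vstar) : D.vlo < vstar ∧ (vstar : EReal) < D.vhi := by
  obtain ⟨-, hmax, huniq⟩ := hv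
  constructor <;> by_contra! h
  · have h1 : vstar - 1 = vstar := huniq _ fun w => by
      rw [D.Δ_eq_zero_of_le (by linarith : vstar - 1 ≤ D.vlo), ← D.Δ_eq_zero_of_le h]
      exact hmax w
    linarith
  · have h1 : vstar + 1 = vstar := huniq _ fun w => by
      rw [D.Δ_eq_zero_of_ge (h.trans (EReal.coe_le_coe_iff.2 (by linarith : vstar ≤ vstar + 1))),
        ← D.Δ_eq_zero_of_ge h]
      exact hmax w
    linarith

lemma fh_le_fl (hv : IsVStar D vstar) {v : ℝ} (h : v ≤ vstar) : D.fh v ≤ D.fl v := by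
  by_cases hm : D.vlo < v ∧ (v : EReal) < D.vhi
  · have hs := vstar_mem hv
    have h1 := D.lr_strictMono.monotoneOn hm hs h
    simp only [← hv.1] at h1
    rw [div_self ((D.fl_pos_iff _).2 hs).ne', div_le_one ((D.fl_pos_iff _).2 hm)] at h1
    exact h1
  · exact (not_lt.1 (mt (D.fh_pos_iff v).1 hm)).trans (D.fl_nonneg v)

lemma fl_le_fh (hv : IsVStar D vstar) {v : ℝ} (h : vstar ≤ v) : D.fl v ≤ D.fh v := by
  by_cases hm : D.vlo < v ∧ (v : EReal) < D.vhi
  · have hs := vstar_mem hv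
    have h1 := D.lr_strictMono.monotoneOn hs hm h
    simp only [← hv.1] at h1
    rw [div_self ((D.fl_pos_iff _).2 hs).ne', one_le_div ((D.fl_pos_iff _).2 hm)] at h1
    exact h1
  · exact (not_lt.1 (mt (D.fl_pos_iff v).1 hm)).trans (D.fh_nonneg v)

lemma h_le_l (hv : IsVStar D vstar) {s : Set ℝ} (hs : MeasurableSet s) (h : s ⊆ Iic vstar) :
    D.μh.real s ≤ D.μl.real s := by
  refine ENNReal.toReal_mono (measure_ne_top _ _) ?_
  rw [D.dens_h, D.dens_l, withDensity_apply _ hs, withDensity_apply _ hs]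
  exact setLIntegral_mono' hs fun v hvs => ENNReal.ofReal_le_ofReal (fh_le_fl hv (h hvs))

lemma l_le_h (hv : IsVStar D vstar) {s : Set ℝ} (hs : MeasurableSet s) (h : s ⊆ Ici vstar) :
    D.μl s ≤ D.μh s := by
  rw [D.dens_h, D.dens_l, withDensity_apply _ hs, withDensity_apply _ hs]
  exact setLIntegral_mono' hs fun v hvs => ENNReal.ofReal_le_ofReal (fl_le_fh hv (h hvs))

lemma Δ_mono (hv : IsVStar D vstar) {a b : ℝ} (hab : a ≤ b) (hb : b ≤ vstar) :
    D.Δ a ≤ D.Δ b := by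
  have h := h_le_l hv (measurableSet_Ioc (a := a) (b := b)) fun x hx => hx.2.trans hb
  rw [← mCdf_sub_mCdf _ hab, ← mCdf_sub_mCdf _ hab] at h
  simp only [Δ, Fl, Fh]; linarith

lemma Δ_anti (hv : IsVStar D vstar) {a b : ℝ} (hab : a ≤ b) (ha : vstar ≤ a) :
    D.Δ b ≤ D.Δ a := by
  have h := ENNReal.toReal_mono (measure_ne_top _ _)
    (l_le_h hv (measurableSet_Ioc (a := a) (b := b)) fun x hx => ha.trans hx.1.le)
  change D.μl.real _ ≤ D.μh.real _ at h
  rw [← mCdf_sub_mCdf _ hab, ← mCdf_sub_mCdf _ hab] at h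
  simp only [Δ, Fl, Fh]; linarith

lemma Δ_nonneg (hv : IsVStar D vstar) (v : ℝ) : 0 ≤ D.Δ v := by
  rcases le_total v vstar with h | h
  · exact sub_nonneg.2 (h_le_l hv measurableSet_Iic (Iic_subset_Iic.2 h))
  · have h1 := ENNReal.toReal_mono (measure_ne_top _ _)
      (l_le_h hv (measurableSet_Ioi (a := v)) fun x hx => h.trans (le_of_lt hx))
    change D.μl.real _ ≤ D.μh.real _ at h1
    rw [← compl_Iic, probReal_compl_eq_one_sub measurableSet_Iic,
      probReal_compl_eq_one_sub measurableSet_Iic] at h1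
    change 0 ≤ D.μl.real (Iic v) - D.μh.real (Iic v)
    linarith

lemma integrable_id_l (hv : IsVStar D vstar) (hmom : Integrable (fun v : ℝ => v) D.μh) :
    Integrable (fun v : ℝ => v) D.μl := by
  rw [← integrableOn_univ, ← Iic_union_Ioi (a := vstar)]
  refine IntegrableOn.union ?_ ?_
  · refine Integrable.of_bound measurable_id.aestronglyMeasurable |vstar| ?_
    filter_upwards [ae_restrict_of_ae D.ae_l_mem, ae_restrict_mem measurableSet_Iic] with v h1 h2
    rw [Real.norm_eq_abs]
    exact abs_le_abs_of_nonneg (D.vlo_nonneg.trans h1.1.le) h2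
  · refine Integrable.mono_measure (hmom.integrableOn (s := Ioi vstar)) ?_
    refine Measure.le_iff.2 fun s hs => ?_
    rw [Measure.restrict_apply hs, Measure.restrict_apply hs]
    exact l_le_h hv (hs.inter measurableSet_Ioi) fun x hx => (mem_Ioi.1 hx.2).le

end MarketData

/-- For every `h`-value in the support, the kernel `γ⋆` only charges `l`-values at which the
potentials add up to the pairwise profit. -/
lemma gammaStar_potentials_ne_pairProfit (D : MarketData) {c α : ℝ} (hc : 0 ≤ c)
    (hα : α ∈ Ioo (0 : ℝ) 1) {vstar : ℝ} (hv : IsVStar D vstar) {κ : Kappa}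
    (hκ : KappaSystem D.Fl D.Fh c α κ) (h4 : κ.k4 < vstar) (h5 : vstar < κ.k5)
    {y : ℝ} (hy : D.vlo < y ∧ (y : EReal) < D.vhi) :
    gammaStar D κ y {x | lPotential α κ x + hPotential c α κ y ≠ pairProfit c α x y} = 0 := by
  obtain ⟨h12, h23, h34, h45, q1, q4, q5, e3, e5⟩ := hκ
  obtain ⟨h0, h1⟩ := hα
  have h13 := h12.trans h23
  have hk1 : 0 < κ.k1 - c := e5 ▸ mul_pos h0 (by linarith)
  have hk2 : κ.k2 ≠ 0 := by linarith
  have F1 := apply_invCdf_of_ne_zero D.continuous_Fl (q1 ▸ hk2)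
  have F4 := apply_invCdf_of_ne_zero D.continuous_Fl (q4 ▸ hk2)
  have F5 := apply_invCdf_of_ne_zero D.continuous_Fl (q5 ▸ hk2)
  rw [← q1] at F1
  rw [← q4] at F4
  rw [← q5] at F5
  change D.Fl κ.k2 = D.Δ κ.k3 + D.Fh κ.k1 at F1
  change D.Fl κ.k2 = D.Δ κ.k4 at F4
  change D.Fl κ.k2 = D.Δ κ.k5 at F5
  have hΔ (v : ℝ) : D.Fl v = D.Fh v + D.Δ v := by rw [MarketData.Δ]; ring
  have hΔ3 := MarketData.Δ_nonneg hv κ.k3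
  have hdirac {x : ℝ} (hx : lPotential α κ x + hPotential c α κ y = pairProfit c α x y) :
      Measure.dirac x {x | lPotential α κ x + hPotential c α κ y ≠ pairProfit c α x y} = 0 := by
    rw [Measure.dirac_apply' _ (isOpen_ne_fun (by
      exact continuous_lPotential.add continuous_const) (by
      exact continuous_pairProfit.comp (Continuous.prodMk_left y))).measurableSet]
    simp [hx]
  -- the potentials always dominate the profit, so only one inequality has to be checked
  have heq {x : ℝ} (hx : lPotential α κ x + hPotential c α κ y ≤ pairProfit c α x y) :
      lPotential α κ x + hPotential c α κ y = pairProfit c α x y :=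
    hx.antisymm (pairProfit_le_potentials ⟨h0, h1⟩ h13 h34 h45 e3 e5 x y)
  unfold gammaStar
  split_ifs with c1 c3 c4 c5
  · set x := lowerDeltaInv D.Δ (D.Fh y + D.Δ κ.k3)
    have hmem : D.Fh y + D.Δ κ.k3 ≤ D.Δ κ.k4 := by linarith [D.Fh_mono c1]
    have hlow : ∀ v ∈ {v | D.Fh y + D.Δ κ.k3 ≤ D.Δ v}, κ.k3 ≤ v := fun v hq => by
      by_contra! hlt
      have a1 := MarketData.Δ_mono hv hlt.le (h34.trans h4.le)
      have a2 := D.Fh_pos hy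
      have a3 : D.Fh y + D.Δ κ.k3 ≤ D.Δ v := hq
      linarith
    have hx3 : κ.k3 ≤ x := le_csInf ⟨_, hmem⟩ hlow
    have hx4 : x ≤ κ.k4 := csInf_le ⟨_, hlow⟩ hmem
    refine hdirac (heq (le_max_of_le_right (le_max_of_le_right ?_)))
    rw [max_eq_left (by nlinarith)]
    simp only [lPotential, hPotential, max_eq_left, max_eq_right, min_eq_left,
      c1, hx3, hx4, h45, h13, h13.trans h34, c1.trans (h13.trans (h34.trans h45))]
    nlinarith
  · rw [not_le] at c1
    set x := invCdf D.Fl (D.Fh y + D.Δ κ.k3)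
    have hmem : D.Fh y + D.Δ κ.k3 ≤ D.Fl κ.k3 := by linarith [D.Fh_mono c3, hΔ κ.k3]
    have hlow : ∀ v ∈ {v | D.Fh y + D.Δ κ.k3 ≤ D.Fl v}, y ≤ v := fun v hq => by
      by_contra! hlt
      have a1 := D.Fl_lt hlt hy
      have a2 := MarketData.Δ_mono hv c3 (h34.trans h4.le)
      have a3 : D.Fh y + D.Δ κ.k3 ≤ D.Fl v := hq
      linarith [hΔ y]
    have hxy : y ≤ x := le_csInf ⟨_, hmem⟩ hlow
    have hx3 : x ≤ κ.k3 := csInf_le ⟨_, hlow⟩ hmem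
    refine hdirac (heq (le_max_of_le_left ?_))
    rw [min_eq_right hxy]
    simp only [lPotential, hPotential, max_eq_left, max_eq_right, min_eq_left,
      c1.le, c3, hx3, hx3.trans h34, h45, c3.trans h34, c3.trans (h34.trans h45)]
    nlinarith
  · rw [not_le] at c1 c3
    refine hdirac (heq (le_max_of_le_left ?_))
    rw [min_self]
    simp only [lPotential, hPotential, max_eq_left, max_eq_right, min_eq_left, min_eq_right,
      c1.le, c3.le, c4, h45, c4.trans h45]
    nlinarith
  · rw [not_le] at c1 c3 c4
    set x := invCdf D.Fl (D.Fh y + D.Δ κ.k4)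
    have hmem : D.Fh y + D.Δ κ.k4 ≤ D.Fl y := by
      have : D.Δ κ.k4 ≤ D.Δ y := by
        rcases le_total y vstar with h | h
        · exact MarketData.Δ_mono hv c4.le h
        · exact F4.symm.trans_le (F5.trans_le (MarketData.Δ_anti hv c5 h))
      linarith [hΔ y]
    have hlow : ∀ v ∈ {v | D.Fh y + D.Δ κ.k4 ≤ D.Fl v}, κ.k4 ≤ v := fun v hq => by
      by_contra! hlt
      have a1 := D.Fl_mono hlt.le
      have a2 := D.Fh_lt c4 hy
      have a3 : D.Fh y + D.Δ κ.k4 ≤ D.Fl v := hq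
      linarith [hΔ κ.k4]
    have hxy : x ≤ y := csInf_le ⟨_, hlow⟩ hmem
    have hx4 : κ.k4 ≤ x := le_csInf ⟨_, hmem⟩ hlow
    refine hdirac (heq (le_max_of_le_left ?_))
    rw [min_eq_left hxy]
    simp only [lPotential, hPotential, max_eq_left, max_eq_right, min_eq_left, min_eq_right,
      c1.le, c3.le, c4.le, c5, hx4, h34.trans hx4, hxy.trans c5]
    nlinarith
  · rw [not_le] at c1 c3 c4 c5
    have hx3 : invCdf D.Fl (D.Δ κ.k5 - D.Δ y) ≤ κ.k3 := by
      by_cases hb : BddBelow {v | D.Δ κ.k5 - D.Δ y ≤ D.Fl v}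
      · refine (csInf_le hb ?_).trans h23
        change D.Δ κ.k5 - D.Δ y ≤ D.Fl κ.k2
        linarith [MarketData.Δ_nonneg hv y]
      · rw [invCdf, Real.sInf_of_not_bddBelow hb]; linarith
    set x := invCdf D.Fl (D.Δ κ.k5 - D.Δ y)
    have hd : Measure.dirac y
        {x | lPotential α κ x + hPotential c α κ y ≠ pairProfit c α x y} = 0 := by
      refine hdirac (heq (le_max_of_le_left ?_))
      rw [min_self]
      simp only [lPotential, hPotential, max_eq_left, min_eq_right,
        c1.le, c3.le, c4.le, c5.le]
      nlinarith
    have hdx : Measure.dirac x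
        {x | lPotential α κ x + hPotential c α κ y ≠ pairProfit c α x y} = 0 := by
      refine hdirac (heq (le_max_of_le_right (le_max_of_le_left ?_)))
      rw [max_eq_left (by linarith)]
      simp only [lPotential, hPotential, max_eq_left, max_eq_right, min_eq_left, min_eq_right,
        c1.le, c3.le, c4.le, c5.le, hx3, hx3.trans h34, h45]
      nlinarith
    rw [Measure.add_apply, Measure.smul_apply, Measure.smul_apply, hd, hdx]
    simp

lemma measure_prod_eq_zero_of_kernel {μ : Measure ℝ} {γ : ℝ → Measure ℝ} {ρ : Measure (ℝ × ℝ)}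
    (hρ : ∀ A B : Set ℝ, MeasurableSet A → MeasurableSet B →
      ρ (A ×ˢ B) = ∫⁻ y in B, γ y A ∂μ) {U : Set (ℝ × ℝ)} (hU : IsOpen U)
    (hγ : ∀ᵐ y ∂μ, γ y {x | (x, y) ∈ U} = 0) : ρ U = 0 := by
  refine measure_null_of_locally_null U fun p hp => ?_
  obtain ⟨A, B, hA, hB, hpA, hpB, hAB⟩ := isOpen_prod_iff.1 hU p.1 p.2 hp
  refine ⟨A ×ˢ B, mem_nhdsWithin_of_mem_nhds (prod_mem_nhds (hA.mem_nhds hpA) (hB.mem_nhds hpB)),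
    ?_⟩
  rw [hρ A B hA.measurableSet hB.measurableSet,
    lintegral_congr_ae (g := fun _ => 0) ?_, lintegral_zero]
  filter_upwards [ae_restrict_of_ae hγ, ae_restrict_mem hB.measurableSet] with y hy hyB
  exact measure_mono_null (fun x hx => hAB ⟨hx, hyB⟩) hy

lemma IsCoupling.integrable_add {μ ν : Measure ℝ} {ρ : Measure (ℝ × ℝ)} (h : IsCoupling μ ν ρ)
    {f g : ℝ → ℝ} (hf : Integrable f μ) (hg : Integrable g ν) :
    Integrable (fun p : ℝ × ℝ => f p.1 + g p.2) ρ := by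
  obtain ⟨rfl, rfl⟩ := h
  exact (hf.comp_measurable measurable_fst).add (hg.comp_measurable measurable_snd)

lemma IsCoupling.integral_add {μ ν : Measure ℝ} {ρ : Measure (ℝ × ℝ)} (h : IsCoupling μ ν ρ)
    {f g : ℝ → ℝ} (hf : Integrable f μ) (hg : Integrable g ν) :
    ∫ p, (f p.1 + g p.2) ∂ρ = ∫ x, f x ∂μ + ∫ y, g y ∂ν := by
  obtain ⟨rfl, rfl⟩ := h
  have h1 : Integrable (fun p : ℝ × ℝ => f p.1) ρ := hf.comp_measurable measurable_fst
  have h2 : Integrable (fun p : ℝ × ℝ => g p.2) ρ := hg.comp_measurable measurable_snd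
  rw [MeasureTheory.integral_add h1 h2, Measure.fst, Measure.snd,
    integral_map measurable_fst.aemeasurable hf.1, integral_map measurable_snd.aemeasurable hg.1]

/-- the coupling `ρ⋆` built from the kernel `γ⋆` maximizes the seller's
matched-pair profit `∫ π dρ` among all couplings of `(F_l, F_h)`. -/
theorem stmt5 (D : MarketData) (c α : ℝ) (hc : 0 ≤ c) (hα : α ∈ Ioo (0 : ℝ) 1)
    (vstar : ℝ) (hv : IsVStar D vstar)
    (hns : D.Fl c < tvDist D.μl D.μh)
    (hmom : Integrable (fun v : ℝ => v) D.μh)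
    (κ : Kappa) (hκ : KappaSystem D.Fl D.Fh c α κ ∧ κ.k4 < vstar ∧ vstar < κ.k5)
    (ρstar : Measure (ℝ × ℝ)) (hρprob : IsProbabilityMeasure ρstar)
    (hρcoupling : IsCoupling D.μl D.μh ρstar)
    (hρdef : ∀ A B : Set ℝ, MeasurableSet A → MeasurableSet B →
      ρstar (A ×ˢ B) = ∫⁻ vh in B, gammaStar D κ vh A ∂D.μh) :
    ∀ ρ : Measure (ℝ × ℝ), IsCoupling D.μl D.μh ρ →
      ∫ p, pairProfit c α p.1 p.2 ∂ρ ≤ ∫ p, pairProfit c α p.1 p.2 ∂ρstar := by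
  intro ρ hρ
  obtain ⟨hκ, h4, h5⟩ := hκ
  have hl : Integrable (lPotential α κ) D.μl :=
    integrable_lPotential (MarketData.integrable_id_l hv hmom)
  have hh : Integrable (hPotential c α κ) D.μh := integrable_hPotential hmom
  have heq : ∀ᵐ p ∂ρstar,
      lPotential α κ p.1 + hPotential c α κ p.2 = pairProfit c α p.1 p.2 := by
    refine measure_prod_eq_zero_of_kernel hρdef (isOpen_ne_fun
      ((continuous_lPotential.comp continuous_fst).add
        (continuous_hPotential.comp continuous_snd)) continuous_pairProfit) ?_
    filter_upwards [D.ae_h_mem] with y hy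
    exact gammaStar_potentials_ne_pairProfit D hc hα hv hκ h4 h5 hy
  rw [← integral_congr_ae heq, hρcoupling.integral_add hl hh, ← hρ.integral_add hl hh]
  obtain ⟨h12, h23, h34, h45, -, -, -, e3, e5⟩ := hκ
  exact integral_mono_of_nonneg (.of_forall fun p => pairProfit_nonneg hα p.1 p.2)
    (hρ.integrable_add hl hh) (.of_forall fun p =>
      pairProfit_le_potentials hα (h12.trans h23) h34 h45 e3 e5 p.1 p.2)
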